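/- arXiv:2110.13564 — 2 statements merged into one kernel-verified Lean document; each statement's English description precedes it below -/
import Mathlib

section
/- (Mehler–Dirichlet integral.) Let γ, μ ∈ ℂ with Re μ < 1/2 and let 0 < θ < π. Then P_γ^μ(cos θ) = √(2/π) · (sin θ)^μ / Γ(1/2 - μ) · ∫_0^θ cos((γ + 1/2)u) · (cos u - cos θ)^{-1/2-μ} du, where cos((γ+1/2)u) is the complex cosine and all complex powers of positive reals are principal branches. -/
noncomputable def pochC (a : ℂ) (n : ℕ) : ℂ := (ascPochhammer ℂ n).eval a

/-- Ferrers function of the first kind `P_ν^μ(x)`. -/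
noncomputable def ferrersP (ν μ : ℂ) (x : ℝ) : ℂ :=
  (((1 + x) / (1 - x) : ℝ) : ℂ) ^ (μ / 2) *
    ∑' n : ℕ, pochC (-ν) n * pochC (ν + 1) n /
        (Complex.Gamma ((n : ℂ) + 1 - μ) * (n.factorial : ℂ)) *
      (((1 - x) / 2 : ℝ) : ℂ) ^ n


open Filter Topology Set MeasureTheory

/-- A sequence whose consecutive ratios tend to `1`; the associated power series converges on the
open unit disc. -/
def HasUnitRatio (b : ℕ → ℂ) : Prop :=
  ∃ q : ℕ → ℂ, Tendsto q atTop (𝓝 1) ∧ ∀ n, b (n + 1) = q n * b n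

/-- Coefficients of the formal derivative of a power series. -/
def derivCoeff (b : ℕ → ℂ) (n : ℕ) : ℂ := (n + 1) * b (n + 1)

lemma hasSum_of_hasSum_succ {f g : ℕ → ℂ} {a : ℂ} (h0 : f 0 = 0) (hfg : ∀ n, f (n + 1) = g n)
    (h : HasSum g a) : HasSum f a := by
  rw [← funext hfg] at h
  simpa [h0] using (hasSum_nat_add_iff 1).mp h

namespace HasUnitRatio

variable {b : ℕ → ℂ}

lemma summable_norm (hb : HasUnitRatio b) {z : ℂ} (hz : ‖z‖ < 1) :
    Summable fun n => ‖b n * z ^ n‖ := by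
  obtain ⟨q, hq, h⟩ := hb
  obtain ⟨r, hzr, hr⟩ := exists_between hz
  refine summable_of_ratio_norm_eventually_le hr ?_
  have hlim : Tendsto (fun n => ‖q n * z‖) atTop (𝓝 ‖z‖) := by
    simpa using (hq.mul_const z).norm
  filter_upwards [hlim.eventually_lt_const hzr] with n hn
  rw [norm_norm, norm_norm, h, pow_succ,
    show q n * b n * (z ^ n * z) = (q n * z) * (b n * z ^ n) by ring, norm_mul]
  gcongr

lemma summable (hb : HasUnitRatio b) {z : ℂ} (hz : ‖z‖ < 1) :
    Summable fun n => b n * z ^ n :=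
  (hb.summable_norm hz).of_norm

lemma derivCoeff (hb : HasUnitRatio b) : HasUnitRatio (derivCoeff b) := by
  obtain ⟨q, hq, h⟩ := hb
  refine ⟨fun n => (2 + 1 * (n : ℂ)) / (1 + 1 * (n : ℂ)) * q (n + 1), ?_, fun n => ?_⟩
  · simpa using (tendsto_add_mul_div_add_mul_atTop_nhds (2 : ℂ) 1 1 one_ne_zero).mul
      (hq.comp (tendsto_add_atTop_nat 1))
  · have hn : (1 + 1 * (n : ℂ)) ≠ 0 := by
      rw [one_mul, add_comm]; exact Nat.cast_add_one_ne_zero n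
    simp only [_root_.derivCoeff]
    rw [h (n + 1)]
    rw [div_mul_eq_mul_div, div_mul_eq_mul_div, eq_div_iff hn]
    push_cast
    ring

lemma hasDerivAt (hb : HasUnitRatio b) {z : ℂ} (hz : ‖z‖ < 1) :
    HasDerivAt (fun w => ∑' n, b n * w ^ n) (∑' n, _root_.derivCoeff b n * z ^ n) z := by
  obtain ⟨r, hzr, hr⟩ := exists_between hz
  have hr0 : 0 ≤ r := (norm_nonneg z).trans hzr.le
  have hrn : ‖(r : ℂ)‖ < 1 := by simpa [abs_of_nonneg hr0] using hr
  have hd := hb.derivCoeff.summable_norm hrn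
  have hu : Summable fun n => ‖b n * (n * (r : ℂ) ^ (n - 1))‖ := by
    rw [← summable_nat_add_iff 1]
    refine hd.congr fun n => ?_
    simp only [_root_.derivCoeff, Nat.add_sub_cancel]
    congr 1
    push_cast
    ring
  have hz' : z ∈ Metric.ball (0 : ℂ) r := by simpa using hzr
  have key := hasDerivAt_tsum_of_isPreconnected (g := fun n w => b n * w ^ n)
    (g' := fun n w => b n * (n * w ^ (n - 1))) hu Metric.isOpen_ball
    (convex_ball (0 : ℂ) r).isPreconnected
    (fun n y _ => (hasDerivAt_pow n y).const_mul (b n))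
    (fun n y hy => by
      have hy' : ‖y‖ ≤ r := by simpa using (mem_ball_zero_iff.mp hy).le
      simp only [norm_mul, norm_pow, Complex.norm_real, Real.norm_of_nonneg hr0]
      gcongr) hz' (hb.summable hz) hz'
  refine key.congr_deriv ?_
  have hs : Summable fun n => b n * (n * z ^ (n - 1)) := by
    rw [← summable_nat_add_iff 1]
    refine (hb.derivCoeff.summable hz).congr fun n => ?_
    simp only [_root_.derivCoeff, Nat.add_sub_cancel]
    push_cast
    ring
  rw [hs.tsum_eq_zero_add]
  simp only [_root_.derivCoeff, Nat.add_sub_cancel, CharP.cast_eq_zero, zero_mul, mul_zero, zero_add]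
  refine tsum_congr fun n => ?_
  push_cast
  ring

lemma hasSum_mul_derivCoeff (hb : HasUnitRatio b) {z : ℂ} (hz : ‖z‖ < 1) :
    HasSum (fun n : ℕ => n * b n * z ^ n) (z * ∑' n, _root_.derivCoeff b n * z ^ n) := by
  refine hasSum_of_hasSum_succ (by simp) (fun n => ?_)
    ((hb.derivCoeff.summable hz).hasSum.mul_left z)
  simp only [_root_.derivCoeff]
  push_cast
  ring

end HasUnitRatio

lemma eq_zero_of_hasDerivAt_mul {s : Set ℝ} (hs : IsOpen s) (hs' : IsPreconnected s) (h0 : 0 ∈ s)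
    {f : ℝ → ℂ} {b : ℂ} (hf : ∀ u ∈ s, HasDerivAt f (b * f u) u) (hf0 : f 0 = 0)
    {u : ℝ} (hu : u ∈ s) : f u = 0 := by
  have hd : ∀ v ∈ s, HasDerivAt (fun v : ℝ => f v * Complex.exp (-b * v)) 0 v := by
    intro v hv
    have he : HasDerivAt (fun v : ℝ => Complex.exp (-b * v)) (Complex.exp (-b * v) * (-b * 1)) v :=
      ((Complex.ofRealCLM.hasDerivAt (x := v)).const_mul (-b)).cexp
    exact ((hf v hv).mul he).congr_deriv (by ring)
  have := hs.is_const_of_deriv_eq_zero hs'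
    (fun v hv => (hd v hv).differentiableAt.differentiableWithinAt)
    (fun v hv => (hd v hv).deriv) hu h0
  simpa [hf0] using this

lemma eq_cos_of_hasDerivAt {s : Set ℝ} (hs : IsOpen s) (hs' : IsPreconnected s) (h0 : 0 ∈ s)
    {h h₁ : ℝ → ℂ} {a : ℂ} (hh : ∀ u ∈ s, HasDerivAt h (h₁ u) u)
    (hh₁ : ∀ u ∈ s, HasDerivAt h₁ (-a ^ 2 * h u) u) (h_zero : h 0 = 1) (h₁_zero : h₁ 0 = 0)
    {u : ℝ} (hu : u ∈ s) : h u = Complex.cos (a * u) := by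
  have hlin (v : ℝ) : HasDerivAt (fun v : ℝ => a * (v : ℂ)) (a * 1) v :=
    (Complex.ofRealCLM.hasDerivAt (x := v)).const_mul a
  set D : ℝ → ℂ := fun v => h v - Complex.cos (a * v) with hD
  set D₁ : ℝ → ℂ := fun v => h₁ v + a * Complex.sin (a * v) with hD₁
  have dD : ∀ v ∈ s, HasDerivAt D (D₁ v) v := fun v hv => by
    refine ((hh v hv).sub ((Complex.hasDerivAt_cos _).comp v (hlin v))).congr_deriv ?_
    simp only [hD₁]; ring
  have dD₁ : ∀ v ∈ s, HasDerivAt D₁ (-a ^ 2 * D v) v := fun v hv => by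
    refine ((hh₁ v hv).add
      (((Complex.hasDerivAt_sin _).comp v (hlin v)).const_mul a)).congr_deriv ?_
    simp only [hD]; ring
  have D_zero : D 0 = 0 := by simp [hD, h_zero]
  have D₁_zero : D₁ 0 = 0 := by simp [hD₁, h₁_zero]
  have factor (c : ℂ) (hc : c ^ 2 = -a ^ 2) : ∀ v ∈ s, D₁ v + c * D v = 0 := fun v hv =>
    eq_zero_of_hasDerivAt_mul (f := fun v => D₁ v + c * D v) (b := c) hs hs' h0 (fun w hw => by
      refine ((dD₁ w hw).add ((dD w hw).const_mul c)).congr_deriv ?_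
      rw [← hc]; ring) (by simp [D_zero, D₁_zero]) hv
  have D₁_eq : ∀ v ∈ s, D₁ v = 0 := fun v hv => by
    have hp := factor (Complex.I * a) (by rw [mul_pow, Complex.I_sq]; ring) v hv
    have hm := factor (-(Complex.I * a)) (by rw [neg_sq, mul_pow, Complex.I_sq]; ring) v hv
    linear_combination (hp + hm) / 2
  exact sub_eq_zero.mp (eq_zero_of_hasDerivAt_mul (f := D) (b := 0) hs hs' h0
    (fun v hv => by simpa [D₁_eq v hv] using dD v hv) D_zero hu)

/-- Coefficients of the hypergeometric series `₂F₁(-γ, γ + 1; 1/2; s)`. -/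
noncomputable def cosCoeff (γ : ℂ) (n : ℕ) : ℂ :=
  pochC (-γ) n * pochC (γ + 1) n / (pochC (1 / 2) n * n.factorial)

lemma pochC_zero (a : ℂ) : pochC a 0 = 1 := by simp [pochC]

lemma pochC_succ (a : ℂ) (n : ℕ) : pochC a (n + 1) = pochC a n * (a + n) := by
  simp [pochC, ascPochhammer_succ_eval]

lemma half_add_natCast_ne_zero (n : ℕ) : (1 / 2 + n : ℂ) ≠ 0 := by
  intro h
  have := congrArg Complex.re h
  norm_num at this
  linarith [n.cast_nonneg (α := ℝ)]

lemma Gamma_natCast_add_half (n : ℕ) :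
    Complex.Gamma (n + 1 / 2) = pochC (1 / 2) n * Complex.Gamma (1 / 2) := by
  induction n with
  | zero => simp [pochC_zero]
  | succ n ih =>
    rw [pochC_succ, Nat.cast_succ, add_right_comm, Complex.Gamma_add_one, ih]
    · ring
    · rw [add_comm]; exact half_add_natCast_ne_zero n

lemma pochC_half_ne_zero (n : ℕ) : pochC (1 / 2) n ≠ 0 := by
  induction n with
  | zero => simp [pochC_zero]
  | succ n ih => rw [pochC_succ]; exact mul_ne_zero ih (half_add_natCast_ne_zero n)

lemma cosCoeff_succ (γ : ℂ) (n : ℕ) :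
    (n + 1) * (1 / 2 + n) * cosCoeff γ (n + 1) = (-γ + n) * (γ + 1 + n) * cosCoeff γ n := by
  have h1 := pochC_half_ne_zero n
  have h2 := half_add_natCast_ne_zero n
  have h3 : (n.factorial : ℂ) ≠ 0 := by exact_mod_cast n.factorial_ne_zero
  have h4 : (n + 1 : ℂ) ≠ 0 := Nat.cast_add_one_ne_zero n
  simp only [cosCoeff, pochC_succ, Nat.factorial_succ, Nat.cast_mul, Nat.cast_succ]
  rw [mul_div_assoc', mul_div_assoc', div_eq_div_iff (by positivity) (by positivity)]
  ring

lemma hasUnitRatio_cosCoeff (γ : ℂ) : HasUnitRatio (cosCoeff γ) := by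
  refine ⟨fun n => ((-γ + 1 * n) / (1 + 1 * n)) * ((γ + 1 + 1 * n) / (1 / 2 + 1 * n)), ?_,
    fun n => ?_⟩
  · simpa using (tendsto_add_mul_div_add_mul_atTop_nhds (-γ) 1 1 one_ne_zero).mul
      (tendsto_add_mul_div_add_mul_atTop_nhds (γ + 1) (1 / 2) 1 one_ne_zero)
  · have h2 := half_add_natCast_ne_zero n
    have h4 : (1 + n : ℂ) ≠ 0 := by rw [add_comm]; exact Nat.cast_add_one_ne_zero n
    have := cosCoeff_succ γ n
    simp only [one_mul]
    rw [div_mul_div_comm, div_mul_eq_mul_div, eq_div_iff (mul_ne_zero h4 h2)]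
    linear_combination this

/-- The hypergeometric differential equation for `₂F₁(-γ, γ + 1; 1/2; z)`. -/
lemma cosCoeff_ode (γ : ℂ) {z : ℂ} (hz : ‖z‖ < 1) :
    z * (1 - z) * (∑' n, derivCoeff (derivCoeff (cosCoeff γ)) n * z ^ n) +
      (1 / 2 - 2 * z) * (∑' n, derivCoeff (cosCoeff γ) n * z ^ n) +
      γ * (γ + 1) * (∑' n, cosCoeff γ n * z ^ n) = 0 := by
  have hc := hasUnitRatio_cosCoeff γ
  have s0 := (hc.summable hz).hasSum
  have s1 := (hc.derivCoeff.summable hz).hasSum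
  have t0 := hc.hasSum_mul_derivCoeff hz
  have t1 := hc.derivCoeff.hasSum_mul_derivCoeff hz
  have t2 : HasSum (fun n : ℕ => n * (n - 1) * cosCoeff γ n * z ^ n)
      (z ^ 2 * ∑' n, derivCoeff (derivCoeff (cosCoeff γ)) n * z ^ n) := by
    rw [pow_two, mul_assoc]
    refine hasSum_of_hasSum_succ (by simp) (fun n => ?_) (t1.mul_left z)
    simp only [derivCoeff]
    push_cast
    ring
  have key := ((((t1.sub t2).add (s1.mul_left (1 / 2))).sub (t0.mul_left 2)).add
    (s0.mul_left (γ * (γ + 1))))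
  have := key.tsum_eq.symm.trans ((tsum_congr fun n => ?_).trans tsum_zero)
  · linear_combination this
  · have := cosCoeff_succ γ n
    simp only [derivCoeff]
    linear_combination z ^ n * this

lemma norm_sin_half_sq_lt_one {u : ℝ} (hu : u ∈ Ioo (-Real.pi) Real.pi) :
    ‖Complex.sin (u / 2) ^ 2‖ < 1 := by
  have hc : 0 < Real.cos (u / 2) :=
    Real.cos_pos_of_mem_Ioo ⟨by linarith [hu.1], by linarith [hu.2]⟩
  have : Complex.sin (u / 2) ^ 2 = ((Real.sin (u / 2) ^ 2 : ℝ) : ℂ) := by push_cast; rfl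
  rw [this, Complex.norm_real, Real.norm_of_nonneg (sq_nonneg _)]
  nlinarith [Real.sin_sq_add_cos_sq (u / 2)]

lemma cos_half_mul_tsum_cosCoeff (γ : ℂ) {u : ℝ} (hu : u ∈ Ioo (-Real.pi) Real.pi) :
    Complex.cos (u / 2) * ∑' n, cosCoeff γ n * (Complex.sin (u / 2) ^ 2) ^ n =
      Complex.cos ((γ + 1 / 2) * u) := by
  have hc := hasUnitRatio_cosCoeff γ
  have hhalf (v : ℝ) : HasDerivAt (fun v : ℝ => (v : ℂ) / 2) (1 / 2) v :=
    (Complex.ofRealCLM.hasDerivAt (x := v)).div_const 2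
  set C : ℝ → ℂ := fun v => Complex.cos (v / 2) with hC
  set S : ℝ → ℂ := fun v => Complex.sin (v / 2) with hS
  set F : ℂ → ℂ := fun z => ∑' n, cosCoeff γ n * z ^ n with hF
  set F₁ : ℂ → ℂ := fun z => ∑' n, derivCoeff (cosCoeff γ) n * z ^ n with hF₁
  set F₂ : ℂ → ℂ := fun z => ∑' n, derivCoeff (derivCoeff (cosCoeff γ)) n * z ^ n with hF₂
  have dC (v : ℝ) : HasDerivAt C (-S v * (1 / 2)) v :=
    (Complex.hasDerivAt_cos _).comp v (hhalf v)
  have dS (v : ℝ) : HasDerivAt S (C v * (1 / 2)) v :=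
    (Complex.hasDerivAt_sin _).comp v (hhalf v)
  have dS2 (v : ℝ) : HasDerivAt (fun v => S v ^ 2) (S v * C v) v :=
    ((dS v).pow 2).congr_deriv (by push_cast; ring)
  have dF : ∀ v ∈ Ioo (-Real.pi) Real.pi,
      HasDerivAt (fun v => F (S v ^ 2)) (F₁ (S v ^ 2) * (S v * C v)) v := fun v hv =>
    HasDerivAt.comp (h₂ := F) v (hc.hasDerivAt (norm_sin_half_sq_lt_one hv)) (dS2 v)
  have dF₁ : ∀ v ∈ Ioo (-Real.pi) Real.pi,
      HasDerivAt (fun v => F₁ (S v ^ 2)) (F₂ (S v ^ 2) * (S v * C v)) v := fun v hv =>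
    HasDerivAt.comp (h₂ := F₁) v (hc.derivCoeff.hasDerivAt (norm_sin_half_sq_lt_one hv)) (dS2 v)
  refine eq_cos_of_hasDerivAt (s := Ioo (-Real.pi) Real.pi) (h := fun v => C v * F (S v ^ 2))
    (h₁ := fun v => -S v * (1 / 2) * F (S v ^ 2) + C v ^ 2 * S v * F₁ (S v ^ 2))
    isOpen_Ioo isPreconnected_Ioo ⟨neg_lt_zero.mpr Real.pi_pos, Real.pi_pos⟩ ?_ ?_ ?_ ?_ hu
  · intro v hv
    exact ((dC v).mul (dF v hv)).congr_deriv (by ring)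
  · intro v hv
    refine ((((dS v).neg.mul_const (1 / 2)).mul (dF v hv)).add
      ((((dC v).pow 2).mul (dS v)).mul (dF₁ v hv))).congr_deriv ?_
    have hode := cosCoeff_ode γ (norm_sin_half_sq_lt_one hv)
    have hpyth : S v ^ 2 + C v ^ 2 = 1 := Complex.sin_sq_add_cos_sq _
    change S v ^ 2 * (1 - S v ^ 2) * F₂ (S v ^ 2) + (1 / 2 - 2 * S v ^ 2) * F₁ (S v ^ 2) +
      γ * (γ + 1) * F (S v ^ 2) = 0 at hode
    simp only [Pi.pow_apply, Pi.mul_apply, Pi.neg_apply]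
    push_cast
    generalize F (S v ^ 2) = a at *
    generalize F₁ (S v ^ 2) = b at *
    generalize F₂ (S v ^ 2) = d at *
    linear_combination C v * hode + (C v * S v ^ 2 * d + C v / 2 * b) * hpyth
  · have : F 0 = 1 := by
      rw [hF]
      simp only
      rw [tsum_eq_single 0 (fun n hn => by simp [hn])]
      simp [cosCoeff, pochC_zero]
    simp [hC, hS, this]
  · simp [hS]

lemma image_sin_sq_half {θ : ℝ} (hθ0 : 0 < θ) (hθπ : θ < Real.pi) :
    InjOn (fun u => Real.sin (u / 2) ^ 2 / Real.sin (θ / 2) ^ 2) (Ioo 0 θ) ∧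
    (fun u => Real.sin (u / 2) ^ 2 / Real.sin (θ / 2) ^ 2) '' Ioo 0 θ = Ioo 0 1 := by
  have hS : 0 < Real.sin (θ / 2) := Real.sin_pos_of_pos_of_lt_pi (by linarith) (by linarith)
  have hmono : StrictMonoOn (fun u => Real.sin (u / 2) ^ 2 / Real.sin (θ / 2) ^ 2) (Icc 0 θ) := by
    intro x hx y hy hxy
    have h0 : 0 ≤ Real.sin (x / 2) :=
      Real.sin_nonneg_of_nonneg_of_le_pi (by linarith [hx.1]) (by linarith [hx.2])
    have h1 : Real.sin (x / 2) < Real.sin (y / 2) :=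
      Real.sin_lt_sin_of_lt_of_le_pi_div_two (by linarith [hx.1, Real.pi_pos])
        (by linarith [hy.2]) (by linarith)
    dsimp only
    gcongr
  refine ⟨hmono.injOn.mono Ioo_subset_Icc_self, Subset.antisymm ?_ ?_⟩
  · rintro _ ⟨u, hu, rfl⟩
    have h0 := hmono (left_mem_Icc.mpr hθ0.le) (Ioo_subset_Icc_self hu) hu.1
    have h1 := hmono (Ioo_subset_Icc_self hu) (right_mem_Icc.mpr hθ0.le) hu.2
    simp only [zero_div, Real.sin_zero, ne_eq, OfNat.ofNat_ne_zero, not_false_eq_true, zero_pow,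
      div_self (pow_pos hS 2).ne'] at h0 h1
    exact ⟨h0, h1⟩
  · have := intermediate_value_Ioo hθ0.le
      (f := fun u => Real.sin (u / 2) ^ 2 / Real.sin (θ / 2) ^ 2) (by fun_prop)
    simpa [div_self (pow_pos hS 2).ne'] using this

/-- Termwise integration of a power series against a beta weight. -/
lemma hasSum_integral_betaWeight {c : ℕ → ℂ} (hc : Summable fun n => ‖c n‖) {β : ℂ}
    (hβ : 0 < β.re) :
    HasSum (fun n : ℕ => c n * Complex.betaIntegral (n + 1 / 2) β)
      (∫ x : ℝ in Ioo 0 1,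
        (x : ℂ) ^ (-(1 / 2) : ℂ) * (1 - x : ℂ) ^ (β - 1) * ∑' n, c n * (x : ℂ) ^ n) := by
  have hpos (n : ℕ) : 0 < ((n : ℂ) + 1 / 2).re := by
    norm_num; positivity
  have hterm (n : ℕ) (x : ℝ) (hx : x ∈ Ioo (0 : ℝ) 1) :
      c n * ((x : ℂ) ^ ((n : ℂ) + 1 / 2 - 1) * (1 - x : ℂ) ^ (β - 1)) =
      (x : ℂ) ^ (-(1 / 2) : ℂ) * (1 - x : ℂ) ^ (β - 1) * (c n * (x : ℂ) ^ n) := by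
    have hx0 : (x : ℂ) ≠ 0 := by exact_mod_cast hx.1.ne'
    rw [show (n : ℂ) + 1 / 2 - 1 = -(1 / 2) + n by ring, Complex.cpow_add _ _ hx0,
      Complex.cpow_natCast]
    ring
  have hint (n : ℕ) : IntegrableOn
      (fun x : ℝ => (x : ℂ) ^ ((n : ℂ) + 1 / 2 - 1) * (1 - x : ℂ) ^ (β - 1)) (Ioo 0 1) :=
    (intervalIntegrable_iff_integrableOn_Ioo_of_le zero_le_one).mp
      (Complex.betaIntegral_convergent (hpos n) hβ)
  have hmem : ∀ᵐ x : ℝ ∂volume.restrict (Ioo (0 : ℝ) 1), x ∈ Ioo (0 : ℝ) 1 :=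
    ae_restrict_mem measurableSet_Ioo
  have hnorm (n : ℕ) {x : ℝ} (hx : x ∈ Ioo (0 : ℝ) 1) : ‖c n * (x : ℂ) ^ n‖ ≤ ‖c n‖ := by
    rw [norm_mul, norm_pow, Complex.norm_real, Real.norm_of_nonneg hx.1.le]
    exact mul_le_of_le_one_right (norm_nonneg _) (pow_le_one₀ hx.1.le hx.2.le)
  have key := hasSum_integral_of_dominated_convergence (μ := volume.restrict (Ioo (0 : ℝ) 1))
    (F := fun (n : ℕ) (x : ℝ) => c n * ((x : ℂ) ^ ((n : ℂ) + 1 / 2 - 1) * (1 - x : ℂ) ^ (β - 1)))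
    (f := fun x : ℝ => (x : ℂ) ^ (-(1 / 2) : ℂ) * (1 - x : ℂ) ^ (β - 1) * ∑' n, c n * (x : ℂ) ^ n)
    (fun n x => ‖(x : ℂ) ^ (-(1 / 2) : ℂ) * (1 - x : ℂ) ^ (β - 1)‖ * ‖c n‖)
    (fun n => ((hint n).const_mul (c n)).aestronglyMeasurable) ?_ ?_ ?_ ?_
  · simpa only [integral_const_mul, Complex.betaIntegral,
      intervalIntegral.integral_of_le zero_le_one, integral_Ioc_eq_integral_Ioo] using key
  · intro n
    filter_upwards [hmem] with x hx
    rw [hterm n x hx, norm_mul]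
    gcongr
    exact hnorm n hx
  · exact .of_forall fun x => hc.mul_left _
  · simp_rw [tsum_mul_left]
    refine Integrable.mul_const (Integrable.norm ?_) _
    have h0 := hint 0
    norm_num at h0 ⊢
    exact h0
  · filter_upwards [hmem] with x hx
    simp_rw [hterm _ x hx]
    exact (Summable.of_norm_bounded hc fun n => hnorm n hx).hasSum.mul_left _

lemma sq_cpow_half {x : ℝ} (hx : 0 < x) (a : ℂ) : ((x ^ 2 : ℝ) : ℂ) ^ (a / 2) = (x : ℂ) ^ a := by
  have hx0 : (x : ℂ) ≠ 0 := by exact_mod_cast hx.ne'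
  have hx2 : ((x ^ 2 : ℝ) : ℂ) ≠ 0 := by exact_mod_cast (pow_pos hx 2).ne'
  rw [Complex.cpow_def_of_ne_zero hx0, Complex.cpow_def_of_ne_zero hx2, ← Complex.ofReal_log hx.le,
    ← Complex.ofReal_log (sq_nonneg x), Real.log_pow]
  push_cast
  ring_nf

lemma sq_cpow_neg_half {x : ℝ} (hx : 0 < x) :
    ((x ^ 2 : ℝ) : ℂ) ^ (-(1 / 2) : ℂ) = (x : ℂ)⁻¹ := by
  rw [← neg_div, sq_cpow_half hx, Complex.cpow_neg_one]

/-- The substitution `x = sin² (u / 2) / sin² (θ / 2)` in the Mehler–Dirichlet integral. -/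
lemma integral_cos_mul_cpow_eq (γ a : ℂ) {θ : ℝ} (hθ0 : 0 < θ) (hθπ : θ < Real.pi) :
    ∫ u in (0 : ℝ)..θ, Complex.cos ((γ + 1 / 2) * (u : ℂ)) *
        ((Real.cos u - Real.cos θ : ℝ) : ℂ) ^ a =
      Real.sin (θ / 2) * ((2 * Real.sin (θ / 2) ^ 2 : ℝ) : ℂ) ^ a *
        ∫ x : ℝ in Ioo 0 1, (x : ℂ) ^ (-(1 / 2) : ℂ) * (1 - x : ℂ) ^ a *
          ∑' n, cosCoeff γ n * ((Real.sin (θ / 2) ^ 2 : ℝ) : ℂ) ^ n * (x : ℂ) ^ n := by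
  obtain ⟨hinj, himage⟩ := image_sin_sq_half hθ0 hθπ
  set S := Real.sin (θ / 2) with hS_def
  have hS : 0 < S := Real.sin_pos_of_pos_of_lt_pi (by linarith) (by linarith)
  have hS0 : (S : ℂ) ≠ 0 := by exact_mod_cast hS.ne'
  have hderiv (u : ℝ) : HasDerivAt (fun u => Real.sin (u / 2) ^ 2 / S ^ 2)
      (Real.sin (u / 2) * Real.cos (u / 2) / S ^ 2) u := by
    refine ((((Real.hasDerivAt_sin _).comp u ((hasDerivAt_id u).div_const 2)).pow 2).div_const
      (S ^ 2)).congr_deriv ?_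
    simp only [Function.comp_apply, id_eq]
    push_cast
    ring
  rw [← integral_const_mul, ← himage, integral_image_eq_integral_abs_deriv_smul measurableSet_Ioo
    (fun u _ => (hderiv u).hasDerivWithinAt) hinj, intervalIntegral.integral_of_le hθ0.le,
    integral_Ioc_eq_integral_Ioo]
  refine setIntegral_congr_fun measurableSet_Ioo fun u hu => ?_
  have hs : 0 < Real.sin (u / 2) :=
    Real.sin_pos_of_pos_of_lt_pi (by linarith [hu.1]) (by linarith [hu.2])
  have hs0 : (Real.sin (u / 2) : ℂ) ≠ 0 := by exact_mod_cast hs.ne'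
  have hc : 0 < Real.cos (u / 2) :=
    Real.cos_pos_of_mem_Ioo ⟨by linarith [hu.1, Real.pi_pos], by linarith [hu.2]⟩
  have hle : 0 ≤ 1 - Real.sin (u / 2) ^ 2 / S ^ 2 := by
    have : Real.sin (u / 2) ^ 2 / S ^ 2 ∈ Ioo (0 : ℝ) 1 := himage ▸ mem_image_of_mem _ hu
    linarith [this.2]
  have hcos : Real.cos u - Real.cos θ = 2 * S ^ 2 * (1 - Real.sin (u / 2) ^ 2 / S ^ 2) := by
    have h1 : Real.cos u = 1 - 2 * Real.sin (u / 2) ^ 2 := by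
      rw [← Real.cos_two_mul_eq_one_sub, mul_div_cancel₀ _ two_ne_zero]
    have h2 : Real.cos θ = 1 - 2 * S ^ 2 := by
      rw [hS_def, ← Real.cos_two_mul_eq_one_sub, mul_div_cancel₀ _ two_ne_zero]
    rw [h1, h2]
    field_simp
    ring
  have hneg : ((Real.sin (u / 2) ^ 2 / S ^ 2 : ℝ) : ℂ) ^ (-(1 / 2) : ℂ) =
      S / Real.sin (u / 2) := by
    rw [← div_pow, sq_cpow_neg_half (div_pos hs hS), Complex.ofReal_div, inv_div]
  have hsum : ∑' n, cosCoeff γ n * ((S ^ 2 : ℝ) : ℂ) ^ n *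
      ((Real.sin (u / 2) ^ 2 / S ^ 2 : ℝ) : ℂ) ^ n =
      ∑' n, cosCoeff γ n * (Complex.sin (u / 2) ^ 2) ^ n := by
    refine tsum_congr fun n => ?_
    rw [mul_assoc, ← mul_pow]
    push_cast
    rw [mul_div_cancel₀ _ (pow_ne_zero 2 hS0)]
  have hmul : ((Real.cos u - Real.cos θ : ℝ) : ℂ) ^ a = ((2 * S ^ 2 : ℝ) : ℂ) ^ a *
      (1 - ((Real.sin (u / 2) ^ 2 / S ^ 2 : ℝ) : ℂ)) ^ a := by
    rw [hcos, Complex.ofReal_mul, Complex.mul_cpow_ofReal_nonneg (by positivity) hle]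
    push_cast
    rfl
  rw [abs_of_pos (by positivity), Complex.real_smul, hneg, hsum, hmul,
    ← cos_half_mul_tsum_cosCoeff γ ⟨by linarith [hu.1, Real.pi_pos], by linarith [hu.2]⟩]
  push_cast at hs0 ⊢
  field_simp

lemma cosCoeff_mul_betaIntegral (γ : ℂ) {μ : ℂ} (hμ : μ.re < 1 / 2) (n : ℕ) :
    cosCoeff γ n * Complex.betaIntegral (n + 1 / 2) (1 / 2 - μ) =
      Complex.Gamma (1 / 2) * Complex.Gamma (1 / 2 - μ) *
        (pochC (-γ) n * pochC (γ + 1) n /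
          (Complex.Gamma ((n : ℂ) + 1 - μ) * (n.factorial : ℂ))) := by
  have hn : 0 < ((n : ℂ) + 1 / 2).re := by norm_num; positivity
  have hβ : 0 < (1 / 2 - μ).re := by norm_num; linarith
  have hbeta := Complex.Gamma_mul_Gamma_eq_betaIntegral hn hβ
  rw [show (n : ℂ) + 1 / 2 + (1 / 2 - μ) = n + 1 - μ by ring, Gamma_natCast_add_half] at hbeta
  have hΓ : Complex.Gamma ((n : ℂ) + 1 - μ) ≠ 0 :=
    Complex.Gamma_ne_zero_of_re_pos (by norm_num; linarith [n.cast_nonneg (α := ℝ)])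
  have hp := pochC_half_ne_zero n
  have hf : (n.factorial : ℂ) ≠ 0 := by exact_mod_cast n.factorial_ne_zero
  rw [cosCoeff, div_mul_eq_mul_div, mul_div_assoc', div_eq_div_iff (by positivity) (by positivity)]
  linear_combination -(pochC (-γ) n * pochC (γ + 1) n * n.factorial) * hbeta

lemma cot_cpow_eq (μ : ℂ) {S C : ℝ} (hS : 0 < S) (hC : 0 < C) :
    ((C / S : ℝ) : ℂ) ^ μ = Real.sqrt (2 / Real.pi) * ((2 * S * C : ℝ) : ℂ) ^ μ *
      (S * ((2 * S ^ 2 : ℝ) : ℂ) ^ (-(1 / 2) - μ)) * Complex.Gamma (1 / 2) := by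
  have hx : 0 < 2 * S ^ 2 := by positivity
  have hx0 : ((2 * S ^ 2 : ℝ) : ℂ) ≠ 0 := by exact_mod_cast hx.ne'
  have hsplit : 2 * S * C = C / S * (2 * S ^ 2) := by field_simp
  have hsq : 2 * S ^ 2 = (Real.sqrt 2 * S) ^ 2 := by
    rw [mul_pow, Real.sq_sqrt zero_le_two]
  have hΓ : Complex.Gamma (1 / 2) = (Real.sqrt Real.pi : ℂ) := by
    rw [← Real.Gamma_one_half_eq, ← Complex.Gamma_ofReal]
    push_cast
    rfl
  have hμ0 : ((2 * S ^ 2 : ℝ) : ℂ) ^ μ ≠ 0 := fun h => hx0 (Complex.cpow_eq_zero_iff _ _ |>.mp h).1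
  have h2 : (Real.sqrt 2 : ℂ) ≠ 0 := by exact_mod_cast (Real.sqrt_pos.mpr two_pos).ne'
  have hπ : (Real.sqrt Real.pi : ℂ) ≠ 0 := by
    exact_mod_cast (Real.sqrt_pos.mpr Real.pi_pos).ne'
  have hS0 : (S : ℂ) ≠ 0 := by exact_mod_cast hS.ne'
  rw [hsplit, Complex.ofReal_mul (C / S), Complex.mul_cpow_ofReal_nonneg (by positivity) hx.le,
    Complex.cpow_sub _ _ hx0, hΓ, Real.sqrt_div zero_le_two]
  have hhalf : ((2 * S ^ 2 : ℝ) : ℂ) ^ (-(1 / 2) : ℂ) = ((Real.sqrt 2 * S : ℝ) : ℂ)⁻¹ := by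
    rw [hsq, sq_cpow_neg_half (by positivity)]
  rw [hhalf]
  generalize ((2 * S ^ 2 : ℝ) : ℂ) ^ μ = X at *
  push_cast
  field_simp

theorem stmt3 (γ μ : ℂ) (hμ : μ.re < 1 / 2) (θ : ℝ) (hθ0 : 0 < θ) (hθπ : θ < Real.pi) :
    ferrersP γ μ (Real.cos θ) =
      (Real.sqrt (2 / Real.pi) : ℂ) * ((Real.sin θ : ℝ) : ℂ) ^ μ / Complex.Gamma (1 / 2 - μ) *
        ∫ u in (0 : ℝ)..θ,
          Complex.cos ((γ + 1 / 2) * (u : ℂ)) *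
            ((Real.cos u - Real.cos θ : ℝ) : ℂ) ^ (-(1 / 2) - μ) := by
  set S := Real.sin (θ / 2) with hS_def
  set C := Real.cos (θ / 2) with hC_def
  have hS : 0 < S := Real.sin_pos_of_pos_of_lt_pi (by linarith) (by linarith)
  have hC : 0 < C := Real.cos_pos_of_mem_Ioo ⟨by linarith, by linarith⟩
  have hpyth : S ^ 2 + C ^ 2 = 1 := Real.sin_sq_add_cos_sq _
  have hcos : Real.cos θ = 1 - 2 * S ^ 2 := by
    rw [hS_def, ← Real.cos_two_mul_eq_one_sub, mul_div_cancel₀ _ two_ne_zero]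
  have hsin : Real.sin θ = 2 * S * C := by
    rw [hS_def, hC_def, ← Real.sin_two_mul, mul_div_cancel₀ _ two_ne_zero]
  have hcot : (1 + Real.cos θ) / (1 - Real.cos θ) = (C / S) ^ 2 := by
    rw [hcos, div_pow, div_eq_div_iff (by nlinarith) (by positivity)]
    linear_combination -(2 * S ^ 2) * hpyth
  have hhalf : (1 - Real.cos θ) / 2 = S ^ 2 := by rw [hcos]; ring
  have hβ : 0 < (1 / 2 - μ).re := by norm_num; linarith
  have hΓ : Complex.Gamma (1 / 2 - μ) ≠ 0 := Complex.Gamma_ne_zero_of_re_pos hβ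
  have hnorm : ‖((S ^ 2 : ℝ) : ℂ)‖ < 1 := by
    rw [Complex.norm_real, Real.norm_of_nonneg (sq_nonneg S)]
    nlinarith
  have hsum := (hasSum_integral_betaWeight
    ((hasUnitRatio_cosCoeff γ).summable_norm hnorm) hβ).tsum_eq
  rw [show (1 / 2 - μ - 1 : ℂ) = -(1 / 2) - μ by ring] at hsum
  have hterm (n : ℕ) : cosCoeff γ n * ((S ^ 2 : ℝ) : ℂ) ^ n *
      Complex.betaIntegral (n + 1 / 2) (1 / 2 - μ) =
      Complex.Gamma (1 / 2) * Complex.Gamma (1 / 2 - μ) *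
        (pochC (-γ) n * pochC (γ + 1) n /
          (Complex.Gamma ((n : ℂ) + 1 - μ) * (n.factorial : ℂ)) * ((S ^ 2 : ℝ) : ℂ) ^ n) := by
    rw [mul_right_comm, cosCoeff_mul_betaIntegral γ hμ]
    ring
  simp_rw [hterm, tsum_mul_left] at hsum
  rw [integral_cos_mul_cpow_eq γ _ hθ0 hθπ, ← hS_def, ← hsum, ferrersP, hcot, hhalf, hsin,
    sq_cpow_half (div_pos hC hS), cot_cpow_eq μ hS hC]
  generalize Complex.Gamma (1 / 2 - μ) = G at *
  field_simp
end

section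
/- Let ν, η ∈ ℂ with Re ν > Re η > -1/2 and let 0 < φ < π. Then e^{i(ν-η)φ} = (Γ(ν + 1/2) · (sin φ)^{1/2-ν} / (Γ(η + 1/2) Γ(ν - η))) · ∫_0^φ e^{i(ν+1/2)θ} · (sin θ)^{ν-η-1} · (sin(φ-θ))^{η-1/2} dθ, where all complex powers of positive reals are principal branches. -/
open MeasureTheory Set Filter Topology

lemma integrableOn_rpow_mul_exp_neg_mul_Ioi {s c : ℝ} (hs : -1 < s) (hc : 0 < c) :
    IntegrableOn (fun t : ℝ => t ^ s * Real.exp (-(c * t))) (Ioi 0) := by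
  simpa using integrableOn_rpow_mul_exp_neg_mul_rpow hs one_pos hc

lemma norm_cpow_mul_exp_neg_mul (a r : ℂ) {t : ℝ} (ht : 0 < t) :
    ‖(t : ℂ) ^ a * Complex.exp (-(r * t))‖ = t ^ a.re * Real.exp (-(r.re * t)) := by
  rw [norm_mul, Complex.norm_cpow_eq_rpow_re_of_pos ht, Complex.norm_exp]
  simp

lemma aestronglyMeasurable_cpow_mul_exp_neg_mul (a r : ℂ) (μ : Measure ℝ) :
    AEStronglyMeasurable (fun t : ℝ => (t : ℂ) ^ a * Complex.exp (-(r * t))) μ := by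
  have : Measurable (fun t : ℝ => (t : ℂ) ^ a) := Complex.measurable_ofReal.pow_const a
  exact Measurable.aestronglyMeasurable (by fun_prop)

lemma integrableOn_cpow_mul_exp_neg_mul_Ioi {a r : ℂ} (ha : -1 < a.re) (hr : 0 < r.re) :
    IntegrableOn (fun t : ℝ => (t : ℂ) ^ a * Complex.exp (-(r * t))) (Ioi 0) := by
  refine (integrableOn_rpow_mul_exp_neg_mul_Ioi ha hr).mono'
    (aestronglyMeasurable_cpow_mul_exp_neg_mul a r _) ?_
  filter_upwards [ae_restrict_mem measurableSet_Ioi] with t ht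
  exact (norm_cpow_mul_exp_neg_mul a r ht).le

lemma differentiableOn_integral_cpow_mul_exp_neg_mul {a : ℂ} (ha : 0 < a.re) :
    DifferentiableOn ℂ (fun r : ℂ => ∫ t : ℝ in Ioi 0, (t : ℂ) ^ (a - 1) * Complex.exp (-(r * t)))
      {r | 0 < r.re} := by
  intro r₀ (hr₀ : 0 < r₀.re)
  have key := hasDerivAt_integral_of_dominated_loc_of_deriv_le (μ := volume.restrict (Ioi (0 : ℝ)))
    (F := fun (r : ℂ) (t : ℝ) => (t : ℂ) ^ (a - 1) * Complex.exp (-(r * t)))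
    (F' := fun (r : ℂ) (t : ℝ) => -t * ((t : ℂ) ^ (a - 1) * Complex.exp (-(r * t))))
    (bound := fun t => t ^ a.re * Real.exp (-(r₀.re / 2 * t)))
    (Metric.ball_mem_nhds r₀ (half_pos hr₀))
    (Eventually.of_forall fun r => aestronglyMeasurable_cpow_mul_exp_neg_mul (a - 1) r _)
    (integrableOn_cpow_mul_exp_neg_mul_Ioi (by simpa using ha) hr₀)
    ((by fun_prop : Measurable fun t : ℝ => -(t : ℂ)).aestronglyMeasurable.mul
      (aestronglyMeasurable_cpow_mul_exp_neg_mul (a - 1) r₀ _))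
    ?_ (integrableOn_rpow_mul_exp_neg_mul_Ioi (by linarith) (half_pos hr₀)) ?_
  · exact key.2.differentiableAt.differentiableWithinAt
  · filter_upwards [ae_restrict_mem measurableSet_Ioi] with t (ht : 0 < t) r hr
    have hre : r₀.re / 2 ≤ r.re := by
      have h := (Complex.abs_re_le_norm (r - r₀)).trans_lt (mem_ball_iff_norm.mp hr)
      rw [Complex.sub_re] at h
      linarith [(abs_lt.mp h).1]
    rw [norm_mul, norm_cpow_mul_exp_neg_mul _ _ ht, norm_neg, Complex.norm_real, Real.norm_eq_abs,
      abs_of_pos ht, ← mul_assoc, Complex.sub_re, Complex.one_re, ← Real.rpow_one_add' ht.le]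
    · rw [add_sub_cancel]
      gcongr
    · linarith
  · refine Eventually.of_forall fun t r _ => ?_
    have h : HasDerivAt (fun r : ℂ => -(r * t)) (-(1 * (t : ℂ))) r :=
      ((hasDerivAt_id r).mul_const _).neg
    refine (h.cexp.const_mul ((t : ℂ) ^ (a - 1))).congr_deriv ?_
    ring

lemma integral_cpow_mul_exp_neg_mul_Ioi_of_re_pos {a r : ℂ} (ha : 0 < a.re) (hr : 0 < r.re) :
    ∫ t : ℝ in Ioi 0, (t : ℂ) ^ (a - 1) * Complex.exp (-(r * t)) =
      Complex.Gamma a * r ^ (-a) := by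
  have hU : IsOpen {r : ℂ | 0 < r.re} := isOpen_lt continuous_const Complex.continuous_re
  have hG : DifferentiableOn ℂ (fun r : ℂ => Complex.Gamma a * r ^ (-a)) {r | 0 < r.re} :=
    fun r hr => ((differentiableAt_id.cpow_const (Or.inl hr)).const_mul _).differentiableWithinAt
  refine ((differentiableOn_integral_cpow_mul_exp_neg_mul ha).analyticOnNhd hU
    ).eqOn_of_preconnected_of_frequently_eq (hG.analyticOnNhd hU) (z₀ := 1)
    (convex_halfSpace_re_gt 0).isPreconnected (by simp) ?_ hr
  have hmap : Tendsto (fun x : ℝ => (x : ℂ)) (𝓝[≠] 1) (𝓝[≠] 1) := by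
    refine tendsto_nhdsWithin_iff.mpr ⟨?_, ?_⟩
    · exact (Complex.continuous_ofReal.tendsto' 1 1 Complex.ofReal_one).mono_left
        nhdsWithin_le_nhds
    · filter_upwards [self_mem_nhdsWithin] with x hx
      simpa using hx
  refine hmap.frequently (Eventually.frequently ?_)
  filter_upwards [nhdsWithin_le_nhds (Ioi_mem_nhds (one_pos (α := ℝ)))] with x (hx : 0 < x)
  rw [Complex.integral_cpow_mul_exp_neg_mul_Ioi ha hx, mul_comm, one_div, Complex.inv_cpow,
    Complex.cpow_neg]
  rw [Complex.arg_ofReal_of_nonneg hx.le]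
  exact Real.pi_pos.ne

lemma ofReal_mul_cpow {t : ℝ} {w : ℂ} (ht : 0 < t) (hw : w ≠ 0) (c : ℂ) :
    ((t : ℂ) * w) ^ c = (t : ℂ) ^ c * w ^ c := by
  have ht' : (t : ℂ) ≠ 0 := by exact_mod_cast ht.ne'
  rw [Complex.cpow_def_of_ne_zero (mul_ne_zero ht' hw), Complex.cpow_def_of_ne_zero ht',
    Complex.cpow_def_of_ne_zero hw, Complex.log_ofReal_mul ht hw, Complex.ofReal_log ht.le,
    add_mul, Complex.exp_add]

/-- The Mellin transform of `(z + s * w) ^ (-(a + b))`, for `z`, `w` in the right half plane. -/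
lemma integral_cpow_mul_add_mul_cpow_Ioi {a b z w : ℂ} (ha : 0 < a.re) (hb : 0 < b.re)
    (hz : 0 < z.re) (hw : 0 < w.re) :
    Complex.Gamma (a + b) * ∫ s : ℝ in Ioi 0, (s : ℂ) ^ (a - 1) * (z + s * w) ^ (-(a + b)) =
      Complex.Gamma a * Complex.Gamma b * w ^ (-a) * z ^ (-b) := by
  have hab : 0 < (a + b).re := by simp only [Complex.add_re]; positivity
  set f : ℝ → ℝ → ℂ := fun s t => (s : ℂ) ^ (a - 1) *
    ((t : ℂ) ^ (a + b - 1) * Complex.exp (-((z + s * w) * t))) with hf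
  have hf' (s t : ℝ) : f s t = (t : ℂ) ^ (a + b - 1) * Complex.exp (-(z * t)) *
      ((s : ℂ) ^ (a - 1) * Complex.exp (-((t * w) * s))) := by
    have : Complex.exp (-((z + s * w) * t)) =
        Complex.exp (-(z * t)) * Complex.exp (-((t * w) * s)) := by
      rw [← Complex.exp_add]; ring_nf
    simp only [hf, this]; ring
  have hmeas : Measurable (Function.uncurry f) := by
    have h1 : Measurable (fun p : ℝ × ℝ => (p.1 : ℂ) ^ (a - 1)) :=
      (Complex.measurable_ofReal.comp measurable_fst).pow_const _
    have h2 : Measurable (fun p : ℝ × ℝ => (p.2 : ℂ) ^ (a + b - 1)) :=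
      (Complex.measurable_ofReal.comp measurable_snd).pow_const _
    have h3 : Measurable (fun p : ℝ × ℝ => Complex.exp (-((z + p.1 * w) * p.2))) := by fun_prop
    exact h1.mul (h2.mul h3)
  have hint : Integrable (Function.uncurry f)
      ((volume.restrict (Ioi 0)).prod (volume.restrict (Ioi 0))) := by
    refine (integrable_prod_iff' hmeas.aestronglyMeasurable).mpr ⟨?_, ?_⟩
    · filter_upwards [ae_restrict_mem measurableSet_Ioi] with t (ht : 0 < t)
      simp only [Function.uncurry_apply_pair, hf']
      refine (integrableOn_cpow_mul_exp_neg_mul_Ioi (by simpa using ha) ?_).const_mul _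
      simpa using mul_pos ht hw
    · have hb' : -1 < b.re - 1 := by linarith
      refine ((integrableOn_rpow_mul_exp_neg_mul_Ioi hb' hz).const_mul
        (w.re⁻¹ ^ a.re * Real.Gamma a.re)).congr ?_
      filter_upwards [ae_restrict_mem measurableSet_Ioi] with t (ht : 0 < t)
      have : ∀ s ∈ Ioi (0 : ℝ), ‖Function.uncurry f (s, t)‖ =
          t ^ (a.re + b.re - 1) * Real.exp (-(z.re * t)) *
            (s ^ (a.re - 1) * Real.exp (-((t * w.re) * s))) := by
        intro s hs
        simp only [Function.uncurry_apply_pair, hf']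
        rw [norm_mul, norm_cpow_mul_exp_neg_mul _ _ ht, norm_cpow_mul_exp_neg_mul _ _ hs]
        simp
      rw [setIntegral_congr_fun measurableSet_Ioi this, integral_const_mul,
        Real.integral_rpow_mul_exp_neg_mul_Ioi ha (mul_pos ht hw), one_div, mul_inv,
        Real.mul_rpow (by positivity) (by positivity), Real.inv_rpow ht.le,
        show a.re + b.re - 1 = a.re + (b.re - 1) by ring, Real.rpow_add ht]
      have := (Real.rpow_pos_of_pos ht a.re).ne'
      field_simp
  have hswap := integral_integral_swap hint
  have hleft : ∀ s ∈ Ioi (0 : ℝ), ∫ t in Ioi 0, f s t =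
      Complex.Gamma (a + b) * ((s : ℂ) ^ (a - 1) * (z + s * w) ^ (-(a + b))) := by
    intro s (hs : 0 < s)
    have : 0 < (z + s * w).re := by simpa using add_pos hz (mul_pos hs hw)
    simp only [hf]
    rw [integral_const_mul, integral_cpow_mul_exp_neg_mul_Ioi_of_re_pos hab this]
    ring
  have hright : ∀ t ∈ Ioi (0 : ℝ), ∫ s in Ioi 0, f s t =
      Complex.Gamma a * w ^ (-a) * ((t : ℂ) ^ (b - 1) * Complex.exp (-(z * t))) := by
    intro t (ht : 0 < t)
    have htw : 0 < ((t : ℂ) * w).re := by simpa using mul_pos ht hw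
    have ht' : (t : ℂ) ≠ 0 := by exact_mod_cast ht.ne'
    have hw' : w ≠ 0 := by rintro rfl; simp at hw
    simp only [hf']
    rw [integral_const_mul, integral_cpow_mul_exp_neg_mul_Ioi_of_re_pos ha htw,
      ofReal_mul_cpow ht hw', show a + b - 1 = a + (b - 1) by ring, Complex.cpow_add _ _ ht',
      Complex.cpow_neg (t : ℂ)]
    have := (Complex.cpow_ne_zero_iff (y := a)).mpr (Or.inl ht')
    field_simp
  rw [setIntegral_congr_fun measurableSet_Ioi hleft, integral_const_mul,
    setIntegral_congr_fun measurableSet_Ioi hright, integral_const_mul,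
    integral_cpow_mul_exp_neg_mul_Ioi_of_re_pos hb hz] at hswap
  rw [hswap]; ring

lemma exp_mul_I_cpow {x : ℝ} (h₁ : -Real.pi < x) (h₂ : x ≤ Real.pi) (c : ℂ) :
    Complex.exp (x * Complex.I) ^ c = Complex.exp (x * Complex.I * c) := by
  rw [Complex.cpow_def_of_ne_zero (Complex.exp_ne_zero _), Complex.log_exp (by simpa) (by simpa)]

section Substitution

variable {φ : ℝ}

lemma sin_pos_and_sin_sub_pos (hπ : φ < Real.pi) {θ : ℝ} (hθ : θ ∈ Ioo 0 φ) :
    0 < Real.sin θ ∧ 0 < Real.sin (φ - θ) :=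
  ⟨Real.sin_pos_of_pos_of_lt_pi hθ.1 (by linarith [hθ.2]),
    Real.sin_pos_of_pos_of_lt_pi (by linarith [hθ.2]) (by linarith [hθ.1])⟩

lemma image_sin_div_sin_sub (h0 : 0 < φ) (hπ : φ < Real.pi) :
    (fun θ => Real.sin θ / Real.sin (φ - θ)) '' Ioo 0 φ = Ioi 0 := by
  ext s
  constructor
  · rintro ⟨θ, hθ, rfl⟩
    obtain ⟨h₁, h₂⟩ := sin_pos_and_sin_sub_pos hπ hθ
    exact div_pos h₁ h₂
  · intro (hs : 0 < s)
    have hφ := Real.sin_pos_of_pos_of_lt_pi h0 hπ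
    have hcont : ContinuousOn (fun θ => Real.sin θ - s * Real.sin (φ - θ)) (Icc 0 φ) := by
      fun_prop
    obtain ⟨θ, hθ, h⟩ := intermediate_value_Ioo h0.le hcont
      (show (0 : ℝ) ∈ Ioo _ _ by simpa using ⟨mul_pos hs hφ, hφ⟩)
    refine ⟨θ, hθ, ?_⟩
    dsimp only at h ⊢
    rw [div_eq_iff (sin_pos_and_sin_sub_pos hπ hθ).2.ne']
    linarith

lemma injOn_sin_div_sin_sub (hπ : φ < Real.pi) :
    InjOn (fun θ => Real.sin θ / Real.sin (φ - θ)) (Ioo 0 φ) := by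
  intro x hx y hy h
  have hφ := Real.sin_pos_of_pos_of_lt_pi (hx.1.trans hx.2) hπ
  dsimp only at h
  rw [div_eq_div_iff (sin_pos_and_sin_sub_pos hπ hx).2.ne'
    (sin_pos_and_sin_sub_pos hπ hy).2.ne'] at h
  have h' : Real.sin φ * Real.sin (x - y) = 0 := by
    simp only [Real.sin_sub] at h ⊢
    linear_combination h
  have := (Real.sin_eq_zero_iff_of_lt_of_lt (by linarith [hx.1, hy.2]) (by linarith [hx.2, hy.1])).mp
    ((mul_eq_zero.mp h').resolve_left hφ.ne')
  linarith

lemma hasDerivAt_sin_div_sin_sub {θ : ℝ} (h : Real.sin (φ - θ) ≠ 0) :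
    HasDerivAt (fun θ => Real.sin θ / Real.sin (φ - θ)) (Real.sin φ / Real.sin (φ - θ) ^ 2) θ := by
  refine ((Real.hasDerivAt_sin θ).div ((hasDerivAt_id θ).const_sub φ).sin h).congr_deriv ?_
  congr 1
  have := Real.sin_add θ (φ - θ)
  rw [add_sub_cancel] at this
  rw [this, id]
  ring

lemma exp_half_add_sin_div_sin_mul_exp {θ : ℝ} (h : Real.sin (φ - θ) ≠ 0) :
    Complex.exp ((φ / 2 : ℝ) * Complex.I) + (Real.sin θ / Real.sin (φ - θ) : ℝ) *
        Complex.exp ((-(φ / 2) : ℝ) * Complex.I) =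
      (Real.sin φ / Real.sin (φ - θ) : ℝ) * Complex.exp ((φ / 2 - θ : ℝ) * Complex.I) := by
  have key : Real.sin (φ - θ) * Complex.exp ((φ / 2 : ℝ) * Complex.I) +
      Real.sin θ * Complex.exp ((-(φ / 2) : ℝ) * Complex.I) =
      Real.sin φ * Complex.exp ((φ / 2 - θ : ℝ) * Complex.I) := by
    obtain ⟨x, rfl⟩ : ∃ x, φ = 2 * x := ⟨φ / 2, by ring⟩
    rw [mul_div_cancel_left₀ x two_ne_zero]
    apply Complex.ext
    · simp only [Complex.add_re, Complex.re_ofReal_mul, Complex.exp_ofReal_mul_I_re, Real.cos_neg,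
        Real.sin_sub, Real.cos_sub, Real.sin_two_mul, Real.cos_two_mul]
      linear_combination -2 * Real.sin θ * Real.cos x * Real.sin_sq_add_cos_sq x
    · simp only [Complex.add_im, Complex.im_ofReal_mul, Complex.exp_ofReal_mul_I_im, Real.sin_neg,
        Real.sin_sub, Real.sin_two_mul, Real.cos_two_mul]
      ring
  have h' : (Real.sin (φ - θ) : ℂ) ≠ 0 := by exact_mod_cast h
  rw [Complex.ofReal_div (Real.sin θ), Complex.ofReal_div (Real.sin φ), div_mul_eq_mul_div,
    div_mul_eq_mul_div, ← key, add_div, mul_div_cancel_left₀ _ h']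

lemma integral_Ioi_comp_sin_div_sin_sub (h0 : 0 < φ) (hπ : φ < Real.pi) (a b : ℂ) :
    ∫ s : ℝ in Ioi 0, (s : ℂ) ^ (a - 1) * (Complex.exp ((φ / 2 : ℝ) * Complex.I) +
        s * Complex.exp ((-(φ / 2) : ℝ) * Complex.I)) ^ (-(a + b)) =
      Complex.exp ((φ / 2 : ℝ) * Complex.I * -(a + b)) * (Real.sin φ : ℂ) ^ (1 - (a + b)) *
        ∫ θ : ℝ in Ioo 0 φ, Complex.exp (Complex.I * (a + b) * θ) *
          (Real.sin θ : ℂ) ^ (a - 1) * (Real.sin (φ - θ) : ℂ) ^ (b - 1) := by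
  rw [← image_sin_div_sin_sub h0 hπ, integral_image_eq_integral_abs_deriv_smul measurableSet_Ioo
    (fun θ hθ => (hasDerivAt_sin_div_sin_sub
      (sin_pos_and_sin_sub_pos hπ hθ).2.ne').hasDerivWithinAt) (injOn_sin_div_sin_sub hπ),
    ← integral_const_mul]
  refine setIntegral_congr_fun measurableSet_Ioo fun θ hθ => ?_
  have hS := Real.sin_pos_of_pos_of_lt_pi h0 hπ
  obtain ⟨h₁, h₂⟩ := sin_pos_and_sin_sub_pos hπ hθ
  rw [exp_half_add_sin_div_sin_mul_exp h₂.ne', ofReal_mul_cpow (div_pos hS h₂)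
    (Complex.exp_ne_zero _), exp_mul_I_cpow (by linarith [hθ.1, hθ.2]) (by linarith [hθ.1, hθ.2]),
    abs_of_pos (by positivity), Complex.real_smul]
  generalize Real.sin φ = S at *
  generalize Real.sin θ = p at *
  generalize Real.sin (φ - θ) = q at *
  have hq : (q : ℂ) ≠ 0 := by exact_mod_cast h₂.ne'
  have hS' : (S : ℂ) ≠ 0 := by exact_mod_cast hS.ne'
  have e : Complex.exp (Complex.I * (a + b) * θ) * Complex.exp ((φ / 2 : ℝ) * Complex.I * -(a + b))
      = Complex.exp ((φ / 2 - θ : ℝ) * Complex.I * -(a + b)) := by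
    rw [← Complex.exp_add]; push_cast; ring_nf
  rw [← e]
  push_cast
  rw [Complex.div_cpow_ofReal_nonneg h₁.le h₂.le, Complex.div_cpow_ofReal_nonneg hS.le h₂.le,
    Complex.cpow_sub _ _ hS', Complex.cpow_neg, Complex.cpow_neg, Complex.cpow_add _ _ hq,
    Complex.cpow_sub a _ hq, Complex.cpow_sub b _ hq, Complex.cpow_one, Complex.cpow_one]
  have h3 := (Complex.cpow_ne_zero_iff (y := a)).mpr (Or.inl hq)
  have h4 := (Complex.cpow_ne_zero_iff (y := b)).mpr (Or.inl hq)
  have h5 := (Complex.cpow_ne_zero_iff (y := a + b)).mpr (Or.inl hS')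
  field_simp

end Substitution

theorem stmt6 (ν η : ℂ) (h1 : -(1 / 2 : ℝ) < η.re) (h2 : η.re < ν.re)
    (φ : ℝ) (h0 : 0 < φ) (hπ : φ < Real.pi) :
    Complex.exp (Complex.I * (ν - η) * (φ : ℂ)) =
      Complex.Gamma (ν + 1 / 2) * ((Real.sin φ : ℝ) : ℂ) ^ (1 / 2 - ν) /
          (Complex.Gamma (η + 1 / 2) * Complex.Gamma (ν - η)) *
        ∫ θ in (0 : ℝ)..φ,
          Complex.exp (Complex.I * (ν + 1 / 2) * (θ : ℂ)) *
            ((Real.sin θ : ℝ) : ℂ) ^ (ν - η - 1) *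
            ((Real.sin (φ - θ) : ℝ) : ℂ) ^ (η - 1 / 2) := by
  obtain ⟨a, rfl⟩ : ∃ a, ν = a + η := ⟨ν - η, by ring⟩
  obtain ⟨b, rfl⟩ : ∃ b, η = b - 1 / 2 := ⟨η + 1 / 2, by ring⟩
  have ha : 0 < a.re := by simpa using h2
  have hb : 0 < b.re := by
    norm_num at h1
    linarith
  have hcos : 0 < Real.cos (φ / 2) :=
    Real.cos_pos_of_mem_Ioo ⟨by linarith [Real.pi_pos], by linarith⟩
  have key := integral_cpow_mul_add_mul_cpow_Ioi ha hb
    (z := Complex.exp ((φ / 2 : ℝ) * Complex.I)) (w := Complex.exp ((-(φ / 2) : ℝ) * Complex.I))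
    (by rwa [Complex.exp_ofReal_mul_I_re]) (by rwa [Complex.exp_ofReal_mul_I_re, Real.cos_neg])
  rw [integral_Ioi_comp_sin_div_sin_sub h0 hπ, exp_mul_I_cpow (by linarith) (by linarith),
    exp_mul_I_cpow (by linarith) (by linarith)] at key
  have hGa := Complex.Gamma_ne_zero_of_re_pos ha
  have hGb := Complex.Gamma_ne_zero_of_re_pos hb
  rw [intervalIntegral.integral_of_le h0.le, integral_Ioc_eq_integral_Ioo,
    show a + (b - 1 / 2) + 1 / 2 = a + b by ring, show b - 1 / 2 + 1 / 2 = b by ring,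
    show a + (b - 1 / 2) - (b - 1 / 2) = a by ring, show b - 1 / 2 - 1 / 2 = b - 1 by ring,
    show 1 / 2 - (a + (b - 1 / 2)) = 1 - (a + b) by ring, div_mul_eq_mul_div,
    eq_div_iff (mul_ne_zero hGb hGa)]
  have e₁ : Complex.exp (Complex.I * a * φ) * Complex.exp ((φ / 2 : ℝ) * Complex.I * -(a + b)) =
      Complex.exp ((-(φ / 2) : ℝ) * Complex.I * -a) *
        Complex.exp ((φ / 2 : ℝ) * Complex.I * -b) := by
    rw [← Complex.exp_add, ← Complex.exp_add]; push_cast; ring_nf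
  refine mul_right_cancel₀ (Complex.exp_ne_zero ((φ / 2 : ℝ) * Complex.I * -(a + b))) ?_
  linear_combination Complex.Gamma b * Complex.Gamma a * e₁ - key
end
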